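/- arXiv:1403.3357 — 11 statements merged into one kernel-verified Lean document; each statement's English description precedes it below -/
import Mathlib

section
/- Let P be an extreme point of the set NS of no-signaling behaviours for the Bell scenario (N, M, d). Then for every input string x₀ : Fin N → Fin M, the number of output strings a : Fin N → Fin d with p(a|x₀) = 0 is at least (d−1)^N; that is, the cardinality of the finite set {a : Fin N → Fin d | P x₀ a = 0} is ≥ (d−1)^N. -/
open Finset

/-- The set of no-signaling behaviours for the Bell scenario `(N, M, d)`:
functions `P : inputs → outputs → ℝ` that are nonnegative, normalized, and
satisfy the no-signaling conditions. -/
def nsBehaviours (N M d : ℕ) : Set ((Fin N → Fin M) → (Fin N → Fin d) → ℝ) :=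
  {P | (∀ x a, 0 ≤ P x a) ∧ (∀ x, ∑ a, P x a = 1) ∧
    (∀ k : Fin N, ∀ x x' : Fin N → Fin M, (∀ j, j ≠ k → x j = x' j) →
      ∀ a : Fin N → Fin d,
        ∑ b : Fin d, P x (Function.update a k b) =
          ∑ b : Fin d, P x' (Function.update a k b))}

/-- One-party perturbation vectors: `e_c - e_last`. -/
def nsG {e : ℕ} (c : Fin e) (b : Fin (e + 1)) : ℝ :=
  (if b = c.castSucc then 1 else 0) - (if b = Fin.last e then 1 else 0)

lemma nsG_sum {e : ℕ} (c : Fin e) : ∑ b, nsG c b = 0 := by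
  simp [nsG, Finset.sum_sub_distrib]

lemma nsG_castSucc {e : ℕ} (c c' : Fin e) :
    nsG c c'.castSucc = if c' = c then 1 else 0 := by
  simp [nsG, Fin.castSucc_ne_last]

/-- The perturbation with coefficients `w`. -/
def nsT {N e : ℕ} (w : (Fin N → Fin e) → ℝ) (a : Fin N → Fin (e + 1)) : ℝ :=
  ∑ c, w c * ∏ k, nsG (c k) (a k)

lemma nsT_castSucc {N e : ℕ} (w : (Fin N → Fin e) → ℝ) (c' : Fin N → Fin e) :
    nsT w (fun k => (c' k).castSucc) = w c' := by
  have h : ∀ c : Fin N → Fin e,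
      (∏ k, (if c' k = c k then (1 : ℝ) else 0)) = if c' = c then 1 else 0 := by
    intro c
    rw [Finset.prod_ite_zero]
    simp [funext_iff]
  simp [nsT, nsG_castSucc, h]

lemma nsT_marginal {N e : ℕ} (w : (Fin N → Fin e) → ℝ) (k : Fin N)
    (a : Fin N → Fin (e + 1)) : ∑ b, nsT w (Function.update a k b) = 0 := by
  unfold nsT
  rw [Finset.sum_comm]
  apply Finset.sum_eq_zero
  intro c _
  rw [← Finset.mul_sum]
  have h : ∀ b, ∏ j, nsG (c j) (Function.update a k b j)
      = nsG (c k) b * ∏ j ∈ Finset.univ.erase k, nsG (c j) (a j) := by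
    intro b
    rw [← Finset.mul_prod_erase _ _ (Finset.mem_univ k)]
    congr 1
    · simp
    · apply Finset.prod_congr rfl
      intro j hj
      rw [Function.update_of_ne (Finset.ne_of_mem_erase hj)]
  simp [h, ← Finset.sum_mul, nsG_sum]

lemma nsT_total {N e : ℕ} (hN : 1 ≤ N) (w : (Fin N → Fin e) → ℝ) :
    ∑ a, nsT w a = 0 := by
  unfold nsT
  rw [Finset.sum_comm]
  apply Finset.sum_eq_zero
  intro c _
  rw [← Finset.mul_sum]
  have h := (Finset.prod_univ_sum (fun _ : Fin N => (Finset.univ : Finset (Fin (e + 1))))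
    (fun k b => nsG (c k) b)).symm
  rw [Fintype.piFinset_univ] at h
  rw [h, Finset.prod_eq_zero (Finset.mem_univ (⟨0, hN⟩ : Fin N)) (nsG_sum _), mul_zero]

/-- Perturbing a behaviour at one input by a small marginal-free tensor. -/
lemma ns_perturb {N M e : ℕ} (hN : 1 ≤ N)
    (P : (Fin N → Fin M) → (Fin N → Fin (e + 1)) → ℝ)
    (hP : P ∈ nsBehaviours N M (e + 1)) (x₀ : Fin N → Fin M)
    (w : (Fin N → Fin e) → ℝ) (t : ℝ) (ht : ∀ a, |t| * |nsT w a| ≤ P x₀ a) :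
    (P + fun x a => if x = x₀ then t * nsT w a else 0) ∈ nsBehaviours N M (e + 1) := by
  obtain ⟨h1, h2, h3⟩ := hP
  have hz : ∀ (x : Fin N → Fin M) (k : Fin N) (a : Fin N → Fin (e + 1)),
      ∑ b, (if x = x₀ then t * nsT w (Function.update a k b) else 0) = 0 := by
    intro x k a
    split_ifs
    · rw [← Finset.mul_sum, nsT_marginal, mul_zero]
    · simp
  refine ⟨?_, ?_, ?_⟩
  · intro x a
    simp only [Pi.add_apply]
    split_ifs with hx
    · subst hx
      have := ht a
      rw [← abs_mul] at this
      linarith [neg_abs_le (t * nsT w a)]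
    · linarith [h1 x a]
  · intro x
    simp only [Pi.add_apply, Finset.sum_add_distrib, h2]
    split_ifs
    · rw [← Finset.mul_sum, nsT_total hN]; simp
    · simp
  · intro k x x' hx a
    simp only [Pi.add_apply, Finset.sum_add_distrib, hz, add_zero]
    exact h3 k x x' hx a

/-- Any extreme point of the no-signaling set has, for every input string `x₀`,
at least `(d-1)^N` output strings of probability zero. -/
theorem extreme_ns_zeros (N M d : ℕ) (hN : 1 ≤ N) (hM : 1 ≤ M) (hd : 1 ≤ d)
    (P : (Fin N → Fin M) → (Fin N → Fin d) → ℝ)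
    (hP : P ∈ Set.extremePoints ℝ (nsBehaviours N M d))
    (x₀ : Fin N → Fin M) :
    (d - 1) ^ N ≤ {a : Fin N → Fin d | P x₀ a = 0}.ncard := by
  classical
  obtain ⟨e, rfl⟩ : ∃ e, d = e + 1 := ⟨d - 1, by omega⟩
  by_contra hlt
  push Not at hlt
  let T : ((Fin N → Fin e) → ℝ) →ₗ[ℝ] ({a : Fin N → Fin (e + 1) // P x₀ a = 0} → ℝ) :=
    { toFun := fun w z => nsT w z.1
      map_add' := by
        intro u v
        ext z
        simp [nsT, add_mul, Finset.sum_add_distrib]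
      map_smul' := by
        intro r u
        ext z
        simp [nsT, Finset.mul_sum, mul_assoc] }
  have hker : LinearMap.ker T ≠ ⊥ := by
    apply LinearMap.ker_ne_bot_of_finrank_lt
    rw [Module.finrank_fintype_fun_eq_card, Module.finrank_fintype_fun_eq_card,
      ← Nat.card_eq_fintype_card]
    rw [← Nat.card_coe_set_eq] at hlt
    have hc : Fintype.card (Fin N → Fin e) = e ^ N := by simp
    rw [hc]
    exact hlt
  obtain ⟨w, hw, hw0⟩ := Submodule.exists_mem_ne_zero_of_ne_bot hker
  have hv : ∀ a, P x₀ a = 0 → nsT w a = 0 := fun a ha => congrFun (LinearMap.mem_ker.1 hw) ⟨a, ha⟩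
  have hPm := hP.1
  have hev : ∀ᶠ t : ℝ in nhdsWithin 0 (Set.Ioi 0), ∀ a, |t| * |nsT w a| ≤ P x₀ a := by
    rw [Filter.eventually_all]
    intro a
    by_cases ha : P x₀ a = 0
    · simp [hv a ha, ha]
    · have hpos : 0 < P x₀ a := lt_of_le_of_ne (hPm.1 x₀ a) (Ne.symm ha)
      have hc : Continuous fun t : ℝ => |t| * |nsT w a| := by fun_prop
      have h := (hc.tendsto 0).eventually_lt_const (u := P x₀ a) (by simpa using hpos)
      exact (h.filter_mono nhdsWithin_le_nhds).mono fun t ht => ht.le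
  obtain ⟨t, ht, htpos⟩ := (hev.and self_mem_nhdsWithin).exists
  have htpos : 0 < t := htpos
  have hA := ns_perturb hN P hPm x₀ w t ht
  have hB := ns_perturb hN P hPm x₀ w (-t) (by simpa using ht)
  have hseg : P ∈ openSegment ℝ (P + fun x a => if x = x₀ then t * nsT w a else 0)
      (P + fun x a => if x = x₀ then (-t) * nsT w a else 0) := by
    refine ⟨1 / 2, 1 / 2, by norm_num, by norm_num, by norm_num, ?_⟩
    ext x a
    simp only [Pi.add_apply, Pi.smul_apply, smul_eq_mul]
    split_ifs <;> ring
  have heq := hP.2 hA hB hseg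
  apply hw0
  ext c
  have h := congrFun (congrFun heq x₀) (fun k => (c k).castSucc)
  simp [nsT_castSucc, htpos.ne'] at h
  simpa using h
end

section
/- Let P be an extreme point of the set NS of no-signaling behaviours for the Bell scenario (N, M, d). Then for every input string x₀ : Fin N → Fin M there exists an output string a : Fin N → Fin d with p(a|x₀) ≥ 1 / (d^N − (d−1)^N). (Here d^N − (d−1)^N ≥ 1, so the bound is well defined.) -/
open Finset

/-- Zero-sum factor. -/
def zsFactor {m : ℕ} (b : Fin m) (a : Fin (m + 1)) : ℝ :=
  (if a = b.castSucc then 1 else 0) - (if a = Fin.last m then 1 else 0)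

lemma zsFactor_sum {m : ℕ} (b : Fin m) : ∑ a, zsFactor b a = 0 := by
  simp [zsFactor]

lemma zsFactor_castSucc {m : ℕ} (b b' : Fin m) :
    zsFactor b b'.castSucc = if b' = b then 1 else 0 := by
  simp [zsFactor, Fin.castSucc_ne_last]

/-- Embedding of coefficient arrays into tensors all of whose one-party marginals vanish. -/
def zsMap (N m : ℕ) : ((Fin N → Fin m) → ℝ) →ₗ[ℝ] ((Fin N → Fin (m + 1)) → ℝ) where
  toFun c := fun a => ∑ b, c b * ∏ k, zsFactor (b k) (a k)
  map_add' c c' := by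
    funext a; simp [add_mul, Finset.sum_add_distrib]
  map_smul' r c := by
    funext a; simp [mul_assoc, Finset.mul_sum]

lemma zsMap_castSucc {N m : ℕ} (c : (Fin N → Fin m) → ℝ) (b : Fin N → Fin m) :
    zsMap N m c (fun k => (b k).castSucc) = c b := by
  change ∑ b', c b' * ∏ k, zsFactor (b' k) (b k).castSucc = c b
  rw [Finset.sum_eq_single b]
  · simp [zsFactor_castSucc]
  · intro b' _ hne
    obtain ⟨k, hk⟩ := Function.ne_iff.mp hne
    rw [Finset.prod_eq_zero (Finset.mem_univ k), mul_zero]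
    rw [zsFactor_castSucc, if_neg (fun h => hk h.symm)]
  · simp

lemma zsMap_marginal {N m : ℕ} (c : (Fin N → Fin m) → ℝ) (k : Fin N)
    (a : Fin N → Fin (m + 1)) :
    ∑ y, zsMap N m c (Function.update a k y) = 0 := by
  change ∑ y, ∑ b, c b * ∏ j, zsFactor (b j) (Function.update a k y j) = 0
  rw [Finset.sum_comm]
  refine Finset.sum_eq_zero fun b _ => ?_
  rw [← Finset.mul_sum]
  have h : ∀ y, ∏ j, zsFactor (b j) (Function.update a k y j)
      = zsFactor (b k) y * ∏ j ∈ Finset.univ.erase k, zsFactor (b j) (a j) := by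
    intro y
    rw [← Finset.mul_prod_erase _ _ (Finset.mem_univ k)]
    congr 1
    · simp
    · refine Finset.prod_congr rfl fun j hj => ?_
      rw [Function.update_of_ne (Finset.ne_of_mem_erase hj)]
  simp_rw [h]
  rw [← Finset.sum_mul, zsFactor_sum, zero_mul, mul_zero]

lemma zsMap_total {N m : ℕ} (hN : 1 ≤ N) (c : (Fin N → Fin m) → ℝ) :
    ∑ a, zsMap N m c a = 0 := by
  change ∑ a : Fin N → Fin (m + 1), ∑ b, c b * ∏ j, zsFactor (b j) (a j) = 0
  rw [Finset.sum_comm]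
  refine Finset.sum_eq_zero fun b _ => ?_
  rw [← Finset.mul_sum]
  have h := Finset.prod_univ_sum (fun _ : Fin N => (Finset.univ : Finset (Fin (m + 1))))
    (fun j y => zsFactor (b j) y)
  rw [Fintype.piFinset_univ] at h
  rw [← h, Finset.prod_eq_zero (Finset.mem_univ (⟨0, hN⟩ : Fin N)) (zsFactor_sum _), mul_zero]

lemma perturb_mem {N M m : ℕ} (hN : 1 ≤ N)
    (P : (Fin N → Fin M) → (Fin N → Fin (m + 1)) → ℝ)
    (hP : P ∈ nsBehaviours N M (m + 1)) (x₀ : Fin N → Fin M)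
    (c : (Fin N → Fin m) → ℝ) (e : ℝ) (he : ∀ a, 0 ≤ P x₀ a + e * zsMap N m c a) :
    (fun x a => P x a + if x = x₀ then e * zsMap N m c a else 0) ∈ nsBehaviours N M (m + 1) := by
  obtain ⟨h1, h2, h3⟩ := hP
  refine ⟨?_, ?_, ?_⟩
  · intro x a
    by_cases hx : x = x₀
    · subst hx; simpa using he a
    · simpa [hx] using h1 x a
  · intro x
    by_cases hx : x = x₀
    · simp [hx, Finset.sum_add_distrib, ← Finset.mul_sum, zsMap_total hN, h2]
    · simp [hx, h2]
  · have key : ∀ k x a, ∑ b, (P x (Function.update a k b) +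
        if x = x₀ then e * zsMap N m c (Function.update a k b) else 0)
        = ∑ b, P x (Function.update a k b) := by
      intro k x a
      by_cases hx : x = x₀
      · simp [hx, Finset.sum_add_distrib, ← Finset.mul_sum, zsMap_marginal]
      · simp [hx]
    intro k x x' hxx a
    simp only [key]
    exact h3 k x x' hxx a

lemma extreme_inj {N M m : ℕ} (hN : 1 ≤ N)
    (P : (Fin N → Fin M) → (Fin N → Fin (m + 1)) → ℝ)
    (hP : P ∈ Set.extremePoints ℝ (nsBehaviours N M (m + 1))) (x₀ : Fin N → Fin M)
    (c : (Fin N → Fin m) → ℝ) (hc : ∀ a, P x₀ a = 0 → zsMap N m c a = 0) : c = 0 := by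
  have hmem := hP.1
  have h1 := hmem.1
  have hev : ∀ᶠ e in nhdsWithin (0 : ℝ) (Set.Ioi 0), ∀ a,
      0 ≤ P x₀ a + e * zsMap N m c a ∧ 0 ≤ P x₀ a + (-e) * zsMap N m c a := by
    rw [Filter.eventually_all]
    intro a
    rcases (h1 x₀ a).eq_or_lt with h0 | hpos
    · refine Filter.Eventually.of_forall fun e => ?_
      simp [hc a h0.symm, ← h0]
    · apply Filter.Eventually.filter_mono nhdsWithin_le_nhds
      have t1 : Filter.Tendsto (fun e : ℝ => P x₀ a + e * zsMap N m c a) (nhds 0)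
          (nhds (P x₀ a + 0 * zsMap N m c a)) := Continuous.tendsto (by fun_prop) 0
      have t2 : Filter.Tendsto (fun e : ℝ => P x₀ a + (-e) * zsMap N m c a) (nhds 0)
          (nhds (P x₀ a + (-0) * zsMap N m c a)) := Continuous.tendsto (by fun_prop) 0
      filter_upwards [t1.eventually (lt_mem_nhds (by simpa using hpos : (0 : ℝ) < P x₀ a + 0 * zsMap N m c a)),
        t2.eventually (lt_mem_nhds (by simpa using hpos : (0 : ℝ) < P x₀ a + (-0) * zsMap N m c a))] with e he1 he2
      exact ⟨he1.le, he2.le⟩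
  obtain ⟨e, he, hepos⟩ := (hev.and self_mem_nhdsWithin).exists
  have hepos : 0 < e := hepos
  have m1 := perturb_mem hN P hmem x₀ c e fun a => (he a).1
  have m2 := perturb_mem hN P hmem x₀ c (-e) fun a => (he a).2
  have heq := hP.2 m1 m2 ⟨1 / 2, 1 / 2, by norm_num, by norm_num, by norm_num, by
    funext x a
    simp only [Pi.add_apply, Pi.smul_apply, smul_eq_mul]
    split_ifs <;> ring⟩
  funext b
  have hb := congrFun (congrFun heq x₀) (fun k => (b k).castSucc)
  simp only [if_true, zsMap_castSucc] at hb
  have : e * c b = 0 := by linarith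
  simpa [hepos.ne'] using this

/-- For any extreme point of the no-signaling set and any input string `x₀`, some
output string has probability at least `1 / (d^N - (d-1)^N)`. -/
theorem extreme_ns_guessing (N M d : ℕ) (hN : 1 ≤ N) (hM : 1 ≤ M) (hd : 1 ≤ d)
    (P : (Fin N → Fin M) → (Fin N → Fin d) → ℝ)
    (hP : P ∈ Set.extremePoints ℝ (nsBehaviours N M d))
    (x₀ : Fin N → Fin M) :
    ∃ a : Fin N → Fin d, 1 / ((d ^ N - (d - 1) ^ N : ℕ) : ℝ) ≤ P x₀ a := by
  classical
  obtain ⟨m, rfl⟩ : ∃ m, d = m + 1 := ⟨d - 1, by omega⟩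
  simp only [Nat.add_sub_cancel]
  let Z := {a : Fin N → Fin (m + 1) // P x₀ a = 0}
  let L : ((Fin N → Fin m) → ℝ) →ₗ[ℝ] (Z → ℝ) :=
    (LinearMap.funLeft ℝ ℝ (Subtype.val : Z → _)) ∘ₗ zsMap N m
  have hL : Function.Injective L := by
    rw [injective_iff_map_eq_zero]
    intro c hc
    exact extreme_inj hN P hP x₀ c fun a ha => congrFun hc ⟨a, ha⟩
  have hdim := LinearMap.finrank_le_finrank_of_injective hL
  have hZ : Fintype.card Z = #{a | P x₀ a = 0} := Fintype.card_subtype _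
  have hsplit := Finset.card_filter_add_card_filter_not (s := Finset.univ) (fun a => P x₀ a = 0)
  simp only [Module.finrank_fintype_fun_eq_card, Fintype.card_fun, Fintype.card_fin,
    Finset.card_univ] at hdim hsplit
  set S : Finset (Fin N → Fin (m + 1)) := {a | ¬ P x₀ a = 0} with hS
  have hcard : #S ≤ (m + 1) ^ N - m ^ N := by omega
  have hsum : ∑ a ∈ S, P x₀ a = 1 := by
    rw [← hP.1.2.1 x₀, hS, Finset.sum_filter_ne_zero]
  have hne : S.Nonempty := by
    rw [Finset.nonempty_iff_ne_empty]
    rintro h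
    simp [h] at hsum
  by_contra! hcon
  have hpos : (0 : ℝ) < #S := by exact_mod_cast hne.card_pos
  have hle : (#S : ℝ) ≤ (((m + 1) ^ N - m ^ N : ℕ) : ℝ) := by exact_mod_cast hcard
  have hlt := Finset.sum_lt_sum_of_nonempty hne (fun a _ => hcon a)
  rw [hsum, Finset.sum_const, nsmul_eq_mul, mul_one_div, lt_div_iff₀ (hpos.trans_le hle)] at hlt
  linarith
end

section
/- Let P be a behaviour in NS for the Bell scenario (N, M, d) and x₀ : Fin N → Fin M an input string. Suppose there exist two distinct functions q₁, q₂ : (Fin N → Fin d) → ℝ, each nonnegative with ∑_a q_i a = 1, such that P x₀ a = (q₁ a + q₂ a)/2 for all a, and such that for every party k : Fin N, every a : Fin N → Fin d and each i ∈ {1,2}, ∑_{b : Fin d} q_i (Function.update a k b) = ∑_{b : Fin d} P x₀ (Function.update a k b). Then P is not an extreme point of NS. -/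
open Finset

/-- If the single-input slice `P x₀` of a no-signaling behaviour can be split as
an even mixture of two distinct distributions with the same one-party-summed
marginals as `P x₀`, then `P` is not extreme in the no-signaling set. -/
theorem not_extreme_of_split (N M d : ℕ) (hN : 1 ≤ N) (hM : 1 ≤ M) (hd : 1 ≤ d)
    (P : (Fin N → Fin M) → (Fin N → Fin d) → ℝ)
    (hP : P ∈ nsBehaviours N M d)
    (x₀ : Fin N → Fin M)
    (q₁ q₂ : (Fin N → Fin d) → ℝ) (hne : q₁ ≠ q₂)
    (h1pos : ∀ a, 0 ≤ q₁ a) (h2pos : ∀ a, 0 ≤ q₂ a)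
    (h1sum : ∑ a, q₁ a = 1) (h2sum : ∑ a, q₂ a = 1)
    (hmix : ∀ a, P x₀ a = (q₁ a + q₂ a) / 2)
    (h1marg : ∀ (k : Fin N) (a : Fin N → Fin d),
      ∑ b : Fin d, q₁ (Function.update a k b) =
        ∑ b : Fin d, P x₀ (Function.update a k b))
    (h2marg : ∀ (k : Fin N) (a : Fin N → Fin d),
      ∑ b : Fin d, q₂ (Function.update a k b) =
        ∑ b : Fin d, P x₀ (Function.update a k b)) :
    P ∉ Set.extremePoints ℝ (nsBehaviours N M d) := by
  classical
  intro hext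
  have key : ∀ q : (Fin N → Fin d) → ℝ, (∀ a, 0 ≤ q a) → ∑ a, q a = 1 →
      (∀ (k : Fin N) (a : Fin N → Fin d), ∑ b : Fin d, q (Function.update a k b) =
        ∑ b : Fin d, P x₀ (Function.update a k b)) →
      Function.update P x₀ q ∈ nsBehaviours N M d := by
    intro q hpos hsum hmarg
    obtain ⟨hp, hs, hns⟩ := hP
    have hm : ∀ (x : Fin N → Fin M) (k : Fin N) (a : Fin N → Fin d),
        ∑ b : Fin d, Function.update P x₀ q x (Function.update a k b) =
          ∑ b : Fin d, P x (Function.update a k b) := by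
      intro x k a
      by_cases hx : x = x₀
      · subst hx
        simpa using hmarg k a
      · simp [Function.update_of_ne hx]
    refine ⟨?_, ?_, ?_⟩
    · intro x a
      by_cases hx : x = x₀
      · subst hx
        simpa using hpos a
      · simpa [Function.update_of_ne hx] using hp x a
    · intro x
      by_cases hx : x = x₀
      · subst hx
        simpa using hsum
      · simpa [Function.update_of_ne hx] using hs x
    · intro k x x' hxx a
      rw [hm, hm]
      exact hns k x x' hxx a
  have h1 := key q₁ h1pos h1sum h1marg
  have h2 := key q₂ h2pos h2sum h2marg
  have hseg : P ∈ openSegment ℝ (Function.update P x₀ q₁) (Function.update P x₀ q₂) := by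
    refine ⟨1 / 2, 1 / 2, by norm_num, by norm_num, by norm_num, ?_⟩
    funext x a
    by_cases hx : x = x₀
    · subst hx
      simp [hmix a]
      ring
    · simp [Function.update_of_ne hx]
      ring
  have e1 : Function.update P x₀ q₁ = P := hext.2 h1 h2 hseg
  have e2 : Function.update P x₀ q₂ = P :=
    hext.2 h2 h1 (by rwa [openSegment_symm])
  have := congrFun (e1.trans e2.symm) x₀
  simp at this
  exact hne this
end

section
/- Fix natural numbers N ≥ 1 and d ≥ 1. The linear subspace W = {h : (Fin N → Fin d) → ℝ | ∀ k : Fin N, ∀ a : Fin N → Fin d, ∑_{b : Fin d} h (Function.update a k b) = 0} of the real vector space (Fin N → Fin d) → ℝ has Module.finrank ℝ W = (d−1)^N. -/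
open Finset

/-- The space of perturbations of a `d^N`-outcome joint distribution of `N`
parties that leave all one-party-summed marginals unchanged. -/
def margZero (N d : ℕ) : Submodule ℝ ((Fin N → Fin d) → ℝ) where
  carrier := {h | ∀ (k : Fin N) (a : Fin N → Fin d),
    ∑ b : Fin d, h (Function.update a k b) = 0}
  add_mem' := by
    intro f g hf hg k a
    simp only [Pi.add_apply, Finset.sum_add_distrib, hf k a, hg k a, add_zero]
  zero_mem' := by
    intro k a
    simp
  smul_mem' := by
    intro c f hf k a
    simp only [Pi.smul_apply, smul_eq_mul, ← Finset.mul_sum, hf k a, mul_zero]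

/-- Restriction to the outcomes all of whose coordinates are nonzero. -/
def margRestrict (N n : ℕ) : margZero N (n + 1) →ₗ[ℝ] ((Fin N → Fin n) → ℝ) where
  toFun h := fun x => h.1 (fun i => (x i).succ)
  map_add' _ _ := rfl
  map_smul' _ _ := rfl

/-- The single-coordinate extension matrix. -/
def margExt {n : ℕ} (b : Fin (n + 1)) (x : Fin n) : ℝ :=
  Fin.cases (motive := fun _ => ℝ) (-1) (fun j => if j = x then 1 else 0) b

theorem margExt_sum {n : ℕ} (x : Fin n) : ∑ b, margExt b x = 0 := by
  simp [Fin.sum_univ_succ, margExt]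

theorem margZero_eq_zero {N n : ℕ} (h : (Fin N → Fin (n + 1)) → ℝ)
    (hh : h ∈ margZero N (n + 1))
    (h0 : ∀ x : Fin N → Fin n, h (fun i => (x i).succ) = 0) :
    ∀ (m : ℕ) (a : Fin N → Fin (n + 1)), #{i | a i = 0} = m → h a = 0 := by
  intro m
  induction m using Nat.strong_induction_on with
  | _ m ih =>
    intro a ha
    by_cases hz : ∃ k, a k = 0
    · obtain ⟨k, hk⟩ := hz
      have h1 := hh k a
      rw [Fin.sum_univ_succ] at h1
      have h2 : Function.update a k 0 = a := by rw [← hk]; exact Function.update_eq_self k a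
      rw [h2, Finset.sum_eq_zero, add_zero] at h1
      · exact h1
      · intro j _
        refine ih _ ?_ _ rfl
        rw [← ha]
        apply Finset.card_lt_card
        rw [Finset.ssubset_iff_of_subset]
        · exact ⟨k, by simp [hk], by simp⟩
        · intro i hi
          by_cases hik : i = k
          · subst hik; simpa using hk
          · simpa [Function.update_of_ne hik] using hi
    · push Not at hz
      have := h0 (fun i => (a i).pred (hz i))
      simpa using this

theorem margRestrict_bijective (N n : ℕ) : Function.Bijective (margRestrict N n) := by
  constructor
  · rw [injective_iff_map_eq_zero]
    intro h hh
    ext a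
    exact margZero_eq_zero h.1 h.2 (fun x => congrFun hh x) _ a rfl
  · intro g
    refine ⟨⟨fun a => ∑ x, g x * ∏ i, margExt (a i) (x i), ?_⟩, ?_⟩
    · intro k a
      rw [Finset.sum_comm]
      refine Finset.sum_eq_zero fun x _ => ?_
      rw [← Finset.mul_sum]
      have : ∀ b, ∏ i, margExt (Function.update a k b i) (x i)
          = margExt b (x k) * ∏ i ∈ univ.erase k, margExt (a i) (x i) := by
        intro b
        rw [← Finset.mul_prod_erase _ _ (Finset.mem_univ k), Function.update_self]
        congr 1
        refine Finset.prod_congr rfl fun i hi => ?_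
        rw [Function.update_of_ne (Finset.ne_of_mem_erase hi)]
      simp only [this]
      rw [← Finset.sum_mul, margExt_sum]
      simp
    · funext y
      change ∑ x, g x * ∏ i, margExt (y i).succ (x i) = g y
      rw [Finset.sum_eq_single y]
      · simp [margExt]
      · intro x _ hx
        obtain ⟨i, hi⟩ := Function.ne_iff.mp hx
        rw [Finset.prod_eq_zero (Finset.mem_univ i), mul_zero]
        simp [margExt, Ne.symm hi]
      · simp

/-- The dimension count underlying Theorem 1 of the paper: the space of
marginal-preserving perturbations has dimension `(d-1)^N`. -/
theorem finrank_margZero (N d : ℕ) (hN : 1 ≤ N) (hd : 1 ≤ d) :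
    Module.finrank ℝ (margZero N d) = (d - 1) ^ N := by
  obtain ⟨n, rfl⟩ : ∃ n, d = n + 1 := ⟨d - 1, by omega⟩
  rw [(LinearEquiv.ofBijective _ (margRestrict_bijective N n)).finrank_eq]
  simp
end

section
/- (Invariance of the Bell expression.) Let N be even, N ≥ 2, and let P : (Fin N → Fin 2) → (Fin N → Fin 2) → ℝ be arbitrary. For every s : Fin N → Fin 2 whose Hamming weight ∑_j (s j : ℕ) is even, the Bell expression satisfies B(T_s P) = B(P). -/
open Finset

/-- The full correlator `⟨x⟩_P` of a behaviour `P` in the `(N,2,2)` scenario. -/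
noncomputable def corr (N : ℕ) (P : (Fin N → Fin 2) → (Fin N → Fin 2) → ℝ)
    (x : Fin N → Fin 2) : ℝ :=
  ∑ a : Fin N → Fin 2, (-1 : ℝ) ^ (∑ j, (a j : ℕ)) * P x a

/-- The flip pattern `m(x,s)`: party `j` has its outcome flipped iff `x j = s j`. -/
def flipPattern (N : ℕ) (x s : Fin N → Fin 2) : Fin N → Fin 2 :=
  fun j => if x j = s j then 1 else 0

/-- The relabelling `T_s P`, flipping outcomes according to the pattern `m(x,s)`. -/
def relabel (N : ℕ) (s : Fin N → Fin 2)
    (P : (Fin N → Fin 2) → (Fin N → Fin 2) → ℝ) :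
    (Fin N → Fin 2) → (Fin N → Fin 2) → ℝ :=
  fun x a => P x (a + flipPattern N x s)

/-- The quadratic form `f(x) = ∑_{j<k} x_j x_k`. -/
def fQuad (N : ℕ) (x : Fin N → Fin 2) : ℕ :=
  ∑ p ∈ Finset.univ.filter (fun p : Fin N × Fin N => p.1 < p.2), (x p.1 : ℕ) * (x p.2 : ℕ)

/-- The generalized Mermin Bell expression of the paper. -/
noncomputable def bellExpr (N : ℕ) (P : (Fin N → Fin 2) → (Fin N → Fin 2) → ℝ) : ℝ :=
  ∑ x ∈ Finset.univ.filter (fun x : Fin N → Fin 2 => Even (∑ j, (x j : ℕ))),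
    (-1 : ℝ) ^ (fQuad N x) * corr N P x

theorem sign_add_aux : ∀ u v : Fin 2,
    (-1 : ℝ) ^ (((u + v : Fin 2)) : ℕ) = (-1) ^ (u : ℕ) * (-1) ^ (v : ℕ) := by
  intro u v
  fin_cases u <;> fin_cases v <;> simp

theorem sign_flip_aux : ∀ u v : Fin 2,
    (-1 : ℝ) ^ (((if u = v then 1 else 0 : Fin 2)) : ℕ)
      = (-1) * ((-1) ^ (u : ℕ) * (-1) ^ (v : ℕ)) := by
  intro u v
  fin_cases u <;> fin_cases v <;> simp

theorem fin_two_add_self_aux : ∀ u v : Fin 2, u + v + v = u := by decide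

theorem sign_flipPattern (N : ℕ) (hN : Even N) (x s : Fin N → Fin 2)
    (hx : Even (∑ j, (x j : ℕ))) (hs : Even (∑ j, (s j : ℕ))) :
    (-1 : ℝ) ^ (∑ j, (flipPattern N x s j : ℕ)) = 1 := by
  rw [← Finset.prod_pow_eq_pow_sum]
  simp only [flipPattern, sign_flip_aux]
  rw [Finset.prod_mul_distrib, Finset.prod_mul_distrib, Finset.prod_pow_eq_pow_sum,
    Finset.prod_pow_eq_pow_sum, hx.neg_one_pow, hs.neg_one_pow]
  simp [hN.neg_one_pow]

theorem corr_relabel (N : ℕ) (hN : Even N) (P : (Fin N → Fin 2) → (Fin N → Fin 2) → ℝ)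
    (x s : Fin N → Fin 2)
    (hx : Even (∑ j, (x j : ℕ))) (hs : Even (∑ j, (s j : ℕ))) :
    corr N (relabel N s P) x = corr N P x := by
  have key : ∀ a : Fin N → Fin 2, a + flipPattern N x s + flipPattern N x s = a := by
    intro a
    funext j
    exact fin_two_add_self_aux _ _
  unfold corr relabel
  refine Finset.sum_nbij' (fun a => a + flipPattern N x s) (fun a => a + flipPattern N x s)
    (by simp) (by simp) (fun a _ => key a) (fun a _ => key a) ?_
  intro a _
  have h : (-1 : ℝ) ^ (∑ j, ((a + flipPattern N x s) j : ℕ)) = (-1) ^ (∑ j, (a j : ℕ)) := by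
    have h2 := sign_flipPattern N hN x s hx hs
    rw [← Finset.prod_pow_eq_pow_sum] at h2 ⊢
    simp only [Pi.add_apply, sign_add_aux]
    rw [Finset.prod_mul_distrib, h2, mul_one, Finset.prod_pow_eq_pow_sum]
  simp only [h]

/-- Invariance of the Bell expression under relabellings `T_s` with `s` of even
Hamming weight, for even `N`. -/
theorem bellExpr_relabel (N : ℕ) (hN : 2 ≤ N) (hNeven : Even N)
    (P : (Fin N → Fin 2) → (Fin N → Fin 2) → ℝ)
    (s : Fin N → Fin 2) (hs : Even (∑ j, (s j : ℕ))) :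
    bellExpr N (relabel N s P) = bellExpr N P := by
  unfold bellExpr
  refine Finset.sum_congr rfl fun x hx => ?_
  rw [corr_relabel N hNeven P x s (Finset.mem_filter.mp hx).2 hs]
end

section
/- (Result 2, conditional form: maximal randomness from unique maximal violation.) Let N be even, N ≥ 2. Let T be a set of functions P : (Fin N → Fin 2) → (Fin N → Fin 2) → ℝ that are nonnegative and normalized (∑_a P x a = 1 for every x), and assume T is closed under the relabelling T_s for every s : Fin N → Fin 2 of even Hamming weight. Suppose P ∈ T satisfies B(P) = 2^{N−1} and that P is the unique element of T attaining this value (i.e. every P' ∈ T with B(P') = 2^{N−1} equals P). Then, for the input x' : Fin N → Fin 2 defined by x' j = 1 for all j except the last party, where x' = 0, the outputs are maximally random: P x' a = 1/2^N for every a : Fin N → Fin 2. -/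
open Finset

/-- Sign of an output string. -/
noncomputable def sg {N : ℕ} (a : Fin N → Fin 2) : ℝ := (-1 : ℝ) ^ (∑ j, (a j : ℕ))

lemma sg_prod {N : ℕ} (a : Fin N → Fin 2) : sg a = ∏ j, (-1 : ℝ) ^ (a j : ℕ) := by
  unfold sg
  rw [Finset.prod_pow_eq_pow_sum]

lemma bit_add (u v : Fin 2) :
    (-1 : ℝ) ^ ((u + v : Fin 2) : ℕ) = (-1) ^ (u : ℕ) * (-1) ^ (v : ℕ) := by
  fin_cases u <;> fin_cases v <;> simp

lemma bit_flip (u v : Fin 2) :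
    (-1 : ℝ) ^ ((if u = v then 1 else 0 : Fin 2) : ℕ)
      = (-1) * ((-1) ^ (u : ℕ) * (-1) ^ (v : ℕ)) := by
  fin_cases u <;> fin_cases v <;> norm_num

lemma sg_add {N : ℕ} (a b : Fin N → Fin 2) : sg (a + b) = sg a * sg b := by
  simp only [sg_prod, ← Finset.prod_mul_distrib, Pi.add_apply, bit_add]

lemma sg_flip {N : ℕ} (hN : Even N) (x s : Fin N → Fin 2) :
    sg (flipPattern N x s) = sg x * sg s := by
  simp only [sg_prod, flipPattern, bit_flip]
  rw [Finset.prod_mul_distrib, Finset.prod_mul_distrib]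
  simp [hN.neg_one_pow]

lemma sg_eq_one {N : ℕ} (a : Fin N → Fin 2) : sg a = 1 ↔ Even (∑ j, (a j : ℕ)) :=
  neg_one_pow_eq_one_iff_even (by norm_num)

lemma sg_cases {N : ℕ} (a : Fin N → Fin 2) : sg a = 1 ∨ sg a = -1 :=
  neg_one_pow_eq_or ℝ _

lemma str_add_self {N : ℕ} (a : Fin N → Fin 2) : a + a = 0 := by
  funext j
  have : ∀ u : Fin 2, u + u = 0 := by decide
  exact this _

lemma bell_relabel {N : ℕ} (hN : Even N) (s : Fin N → Fin 2) (hs : sg s = 1)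
    (P : (Fin N → Fin 2) → (Fin N → Fin 2) → ℝ) :
    bellExpr N (relabel N s P) = bellExpr N P := by
  unfold bellExpr
  refine Finset.sum_congr rfl fun x hx => ?_
  have hx1 : sg x = 1 := (sg_eq_one x).2 (Finset.mem_filter.1 hx).2
  congr 1
  have hm : sg (flipPattern N x s) = 1 := by rw [sg_flip hN, hx1, hs, one_mul]
  change ∑ a, sg a * P x (a + flipPattern N x s) = ∑ a, sg a * P x a
  refine Fintype.sum_equiv (Equiv.addRight (flipPattern N x s)) _ _ fun a => ?_
  simp [sg_add, hm]

lemma sg_special (N : ℕ) (hN : 2 ≤ N) (hNeven : Even N) :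
    sg (fun j : Fin N => if (j : ℕ) = N - 1 then (0 : Fin 2) else 1) = -1 := by
  obtain ⟨n, rfl⟩ : ∃ n, N = n + 1 := ⟨N - 1, by omega⟩
  have ho : Odd n := by
    rw [← Nat.not_even_iff_odd]
    intro h
    exact (Nat.even_add_one.1 hNeven) h
  rw [sg_prod, Fin.prod_univ_castSucc]
  have h : ∀ i : Fin n, (i : ℕ) ≠ n := fun i => i.2.ne
  simp [h, ho.neg_one_pow]

/-- Result 2 (conditional form): in any theory `T` closed under even-weight
relabellings, a behaviour that is the unique maximizer of the generalized Mermin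
expression at its algebraic value `2^(N-1)` is maximally random on the input
which is all-ones except `0` for the last party. -/
theorem maximal_randomness_of_unique_max (N : ℕ) (hN : 2 ≤ N) (hNeven : Even N)
    (T : Set ((Fin N → Fin 2) → (Fin N → Fin 2) → ℝ))
    (hT : ∀ P ∈ T, (∀ x a, 0 ≤ P x a) ∧ (∀ x, ∑ a, P x a = 1))
    (hclosed : ∀ s : Fin N → Fin 2, Even (∑ j, (s j : ℕ)) →
      ∀ P ∈ T, relabel N s P ∈ T)
    (P : (Fin N → Fin 2) → (Fin N → Fin 2) → ℝ) (hP : P ∈ T)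
    (hmax : bellExpr N P = 2 ^ (N - 1))
    (huniq : ∀ P' ∈ T, bellExpr N P' = 2 ^ (N - 1) → P' = P)
    (a : Fin N → Fin 2) :
    P (fun j => if (j : ℕ) = N - 1 then 0 else 1) a = 1 / 2 ^ N := by
  have hspec := sg_special N hN hNeven
  generalize (fun j : Fin N => if (j : ℕ) = N - 1 then (0 : Fin 2) else 1) = xin at hspec ⊢
  have hinv : ∀ s, sg s = 1 → relabel N s P = P := fun s hs =>
    huniq _ (hclosed s ((sg_eq_one s).1 hs) P hP) ((bell_relabel hNeven s hs P).trans hmax)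
  have hodd : ∀ b, sg b = -1 → ∀ c, P xin (c + b) = P xin c := by
    intro b hb c
    have hbit : ∀ u v : Fin 2, (if u = (if u = v then 1 else 0 : Fin 2) then 1 else 0 : Fin 2) = v := by
      decide
    have hfl : flipPattern N xin (flipPattern N xin b) = b := by
      funext j
      exact hbit _ _
    have hs : sg (flipPattern N xin b) = 1 := by
      rw [sg_flip hNeven, hspec, hb]
      norm_num
    have h := congrFun (congrFun (hinv _ hs) xin) c
    unfold relabel at h
    rwa [hfl] at h
  have hall : ∀ b c, P xin (c + b) = P xin c := by
    intro b c
    rcases sg_cases b with hb | hb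
    · have h1 : sg (b + xin) = -1 := by rw [sg_add, hb, hspec, one_mul]
      have h2 : c + b = (c + (b + xin)) + xin := by
        rw [add_assoc, add_assoc, str_add_self, add_zero]
      rw [h2, hodd _ hspec, hodd _ h1]
    · exact hodd b hb c
  have hconst : ∀ c, P xin c = P xin a := fun c => by
    have := hall (c - a) a
    rwa [add_sub_cancel] at this
  have hsum := (hT P hP).2 xin
  rw [Finset.sum_congr rfl fun c _ => hconst c] at hsum
  simp at hsum
  rw [eq_div_iff (by positivity), mul_comm]
  exact hsum
end

section
/- (GHZ state attains the algebraic maximum of the Bell expression.) Let N ≥ 1. Define the 2×2 complex matrices X = !![0, 1; 1, 0] and Y = !![0, −Complex.I; Complex.I, 0]. For x : Fin N → Fin 2, define the matrix O_x : Matrix (Fin N → Fin 2) (Fin N → Fin 2) ℂ entrywise by O_x a b = ∏_{j : Fin N} (if x j = 0 then X else Y) (a j) (b j) (the N-fold Kronecker product of X's and Y's). Let ψ : (Fin N → Fin 2) → ℂ be the GHZ state: ψ a = (Real.sqrt 2)⁻¹ if a is the all-zeros string or the all-ones string, and ψ a = 0 otherwise. Then ∑_{x : ∑_j (x j : ℕ)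 even} (−1)^{f(x)} * (∑_{a,b} conj (ψ a) * O_x a b * ψ b) = 2^{N−1}, where f(x) := ∑_{j < k} (x j : ℕ) * (x k : ℕ). -/
open Finset

/-- The Pauli matrix `X`. -/
noncomputable def pauliX : Matrix (Fin 2) (Fin 2) ℂ := !![0, 1; 1, 0]

/-- The Pauli matrix `Y`. -/
noncomputable def pauliY : Matrix (Fin 2) (Fin 2) ℂ := !![0, -Complex.I; Complex.I, 0]

/-- The `N`-fold Kronecker product of Pauli `X`'s (input 0) and `Y`'s (input 1)
prescribed by the input string `x`. -/
noncomputable def pauliProd (N : ℕ) (x : Fin N → Fin 2) :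
    Matrix (Fin N → Fin 2) (Fin N → Fin 2) ℂ :=
  Matrix.of fun a b => ∏ j : Fin N, (if x j = 0 then pauliX else pauliY) (a j) (b j)

/-- The `N`-qubit GHZ state `(|0…0⟩ + |1…1⟩)/√2`. -/
noncomputable def ghzState (N : ℕ) : (Fin N → Fin 2) → ℂ :=
  fun a => if (∀ j, a j = 0) ∨ (∀ j, a j = 1) then ((Real.sqrt 2)⁻¹ : ℝ) else 0

theorem ghz_split (N : ℕ) (hN : 1 ≤ N) (a : Fin N → Fin 2) :
    ghzState N a = (if a = (fun _ => 0) then (((Real.sqrt 2)⁻¹ : ℝ) : ℂ) else 0)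
      + (if a = (fun _ => 1) then (((Real.sqrt 2)⁻¹ : ℝ) : ℂ) else 0) := by
  unfold ghzState
  have h0 : (∀ j, a j = 0) ↔ a = (fun _ => 0) := funext_iff.symm
  have h1 : (∀ j, a j = 1) ↔ a = (fun _ => 1) := funext_iff.symm
  simp only [h0, h1]
  by_cases ha : a = (fun _ => 0)
  · have : ¬ a = (fun _ => 1) := by
      intro hb
      have := congrFun (ha.symm.trans hb) ⟨0, hN⟩
      simp at this
    rw [if_pos (Or.inl ha), if_pos ha, if_neg this, add_zero]
  · simp [ha]

theorem fQuad_weight (N : ℕ) (x : Fin N → Fin 2) :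
    2 * fQuad N x + ∑ j, (x j : ℕ) = (∑ j, (x j : ℕ)) ^ 2 := by
  have hsq : (∑ j, (x j : ℕ)) ^ 2 = ∑ p : Fin N × Fin N, (x p.1 : ℕ) * (x p.2 : ℕ) := by
    rw [sq, Finset.sum_mul_sum, Fintype.sum_prod_type]
  have hd : ∑ j, (x j : ℕ) = ∑ p : Fin N × Fin N, if p.1 = p.2 then (x p.1 : ℕ) * (x p.2 : ℕ) else 0 := by
    rw [Fintype.sum_prod_type]
    refine Finset.sum_congr rfl fun j _ => ?_
    simp only [Finset.sum_ite_eq, Finset.mem_univ, if_true]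
    generalize x j = t
    fin_cases t <;> rfl
  have hl : fQuad N x = ∑ p : Fin N × Fin N, if p.1 < p.2 then (x p.1 : ℕ) * (x p.2 : ℕ) else 0 := by
    unfold fQuad
    rw [Finset.sum_filter]
  have hg : fQuad N x = ∑ p : Fin N × Fin N, if p.2 < p.1 then (x p.1 : ℕ) * (x p.2 : ℕ) else 0 := by
    rw [hl, ← Equiv.sum_comp (Equiv.prodComm (Fin N) (Fin N))]
    refine Finset.sum_congr rfl fun p _ => ?_
    simp [mul_comm]
  rw [hsq, two_mul]
  nth_rewrite 1 [hl]
  rw [hg, hd, ← Finset.sum_add_distrib, ← Finset.sum_add_distrib]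
  refine Finset.sum_congr rfl fun p _ => ?_
  rcases lt_trichotomy p.1 p.2 with h | h | h
  · simp [h, h.ne, h.not_gt]
  · simp [h]
  · simp [h, h.ne', h.not_gt]

theorem pauli_vals (N : ℕ) (hN : 1 ≤ N) (x : Fin N → Fin 2) :
    pauliProd N x (fun _ => 0) (fun _ => 0) = 0 ∧
    pauliProd N x (fun _ => 1) (fun _ => 1) = 0 ∧
    pauliProd N x (fun _ => 0) (fun _ => 1) = (-Complex.I) ^ (∑ j, (x j : ℕ)) ∧
    pauliProd N x (fun _ => 1) (fun _ => 0) = Complex.I ^ (∑ j, (x j : ℕ)) := by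
  simp only [pauliProd, Matrix.of_apply]
  refine ⟨?_, ?_, ?_, ?_⟩
  · refine Finset.prod_eq_zero (Finset.mem_univ (⟨0, hN⟩ : Fin N)) ?_
    split_ifs <;> simp [pauliX, pauliY]
  · refine Finset.prod_eq_zero (Finset.mem_univ (⟨0, hN⟩ : Fin N)) ?_
    split_ifs <;> simp [pauliX, pauliY]
  · rw [← Finset.prod_pow_eq_pow_sum]
    refine Finset.prod_congr rfl fun j _ => ?_
    generalize x j = t
    fin_cases t <;> simp [pauliX, pauliY]
  · rw [← Finset.prod_pow_eq_pow_sum]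
    refine Finset.prod_congr rfl fun j _ => ?_
    generalize x j = t
    fin_cases t <;> simp [pauliX, pauliY]

theorem correlator (N : ℕ) (hN : 1 ≤ N) (x : Fin N → Fin 2) :
    (∑ a : Fin N → Fin 2, ∑ b : Fin N → Fin 2,
          (starRingEnd ℂ) (ghzState N a) * pauliProd N x a b * ghzState N b)
      = ((-Complex.I) ^ (∑ j, (x j : ℕ)) + Complex.I ^ (∑ j, (x j : ℕ))) / 2 := by
  obtain ⟨h1, h2, h3, h4⟩ := pauli_vals N hN x
  have hc : (((Real.sqrt 2)⁻¹ : ℝ) : ℂ) * (((Real.sqrt 2)⁻¹ : ℝ) : ℂ) = 1 / 2 := by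
    rw [← Complex.ofReal_mul, ← mul_inv, Real.mul_self_sqrt (by norm_num)]
    norm_num
  simp only [ghz_split N hN, map_add, apply_ite (starRingEnd ℂ), Complex.conj_ofReal, map_zero]
  generalize (((Real.sqrt 2)⁻¹ : ℝ) : ℂ) = c at hc
  simp only [mul_add, add_mul, Finset.sum_add_distrib, mul_ite, ite_mul, mul_zero, zero_mul,
    Finset.sum_ite_eq', Finset.mem_univ, if_true, h1, h2, h3, h4]
  linear_combination ((-Complex.I) ^ (∑ j, (x j : ℕ)) + Complex.I ^ (∑ j, (x j : ℕ))) * hc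

theorem term_one (N : ℕ) (hN : 1 ≤ N) (x : Fin N → Fin 2) (hx : Even (∑ j, (x j : ℕ))) :
    (-1 : ℂ) ^ (fQuad N x) *
        (∑ a : Fin N → Fin 2, ∑ b : Fin N → Fin 2,
          (starRingEnd ℂ) (ghzState N a) * pauliProd N x a b * ghzState N b) = 1 := by
  rw [correlator N hN, hx.neg_pow]
  have hf := fQuad_weight N x
  obtain ⟨m, hm⟩ := hx
  rw [hm] at hf ⊢
  have hf' : fQuad N x + m = 2 * (m * m) := by nlinarith
  rw [← two_mul m, pow_mul, Complex.I_sq, add_self_div_two, ← pow_add, hf', pow_mul]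
  simp

theorem count_even (N : ℕ) (hN : 1 ≤ N) :
    ∑ x ∈ Finset.univ.filter (fun x : Fin N → Fin 2 => Even (∑ j, (x j : ℕ))), (1 : ℂ)
      = 2 ^ (N - 1) := by
  have h0 : ∑ x : Fin N → Fin 2, (-1 : ℂ) ^ (∑ j, (x j : ℕ)) = 0 := by
    simp only [← Finset.prod_pow_eq_pow_sum]
    have := Finset.prod_univ_sum (fun _ : Fin N => (Finset.univ : Finset (Fin 2)))
      (fun _ t => (-1 : ℂ) ^ (t : ℕ))
    rw [Fintype.piFinset_univ] at this
    rw [← this]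
    refine Finset.prod_eq_zero (Finset.mem_univ ⟨0, hN⟩) ?_
    simp
  have ht : ∑ x : Fin N → Fin 2, (1 : ℂ) = 2 ^ N := by simp
  have : ∀ x : Fin N → Fin 2, (if Even (∑ j, (x j : ℕ)) then (1 : ℂ) else 0)
      = (1 + (-1 : ℂ) ^ (∑ j, (x j : ℕ))) / 2 := by
    intro x
    split_ifs with h
    · rw [h.neg_one_pow]; norm_num
    · rw [(Nat.not_even_iff_odd.mp h).neg_one_pow]; norm_num
  rw [Finset.sum_filter, Finset.sum_congr rfl fun x _ => this x, ← Finset.sum_div,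
    Finset.sum_add_distrib, h0, ht]
  obtain ⟨n, rfl⟩ := Nat.exists_eq_add_of_le' hN
  simp [pow_succ]

/-- The GHZ state attains the algebraic maximum `2^(N-1)` of the generalized
Mermin Bell expression, measuring `X` for input 0 and `Y` for input 1. -/
theorem ghz_attains_max (N : ℕ) (hN : 1 ≤ N) :
    ∑ x ∈ Finset.univ.filter (fun x : Fin N → Fin 2 => Even (∑ j, (x j : ℕ))),
      (-1 : ℂ) ^ (fQuad N x) *
        (∑ a : Fin N → Fin 2, ∑ b : Fin N → Fin 2,
          (starRingEnd ℂ) (ghzState N a) * pauliProd N x a b * ghzState N b)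
      = 2 ^ (N - 1) := by
  rw [← count_even N hN]
  exact Finset.sum_congr rfl fun x hx => term_one N hN x (Finset.mem_filter.mp hx).2
end

section
/- (Operator relations at maximal Mermin violation.) Let H be an inner product space over ℂ and let A₀, A₁, B₀, B₁, C₀, C₁ : H →ₗ[ℂ] H be linear maps such that: each of the six maps T is symmetric (⟪T v, w⟫ = ⟪v, T w⟫ for all v, w) and is an involution (T ∘ T = id); each A_i commutes with each B_j and each C_k, and each B_j commutes with each C_k (operators of distinct parties commute; no commutation is assumed within a party). Let ψ ∈ H satisfy A₀ (B₀ (C₁ ψ)) = ψ, A₀ (B₁ (C₀ ψ)) = ψ, A₁ (B₀ (C₀ ψ)) = ψ, and A₁ (B₁ (C₁ ψ)) = −ψ. Then: (i) A₀ (A₁ ψ) = B₀ (B₁ ψ) = C₀ (C₁ ψ); (ii) A₁ (A₀ ψ) = −A₀ (A₁ ψ), B₁ (B₀ ψ) = −B₀ (B₁ ψ), and C₁ (C₀ ψ) = −C₀ (C₁ ψ); (iii) consequently Re ⟪ψ, A₀ (A₁ ψ)⟫ = Re ⟪ψ, B₀ (B₁ ψ)⟫ = Re ⟪ψ, C₀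 (C₁ ψ)⟫ = 0. -/
open scoped ComplexInnerProductSpace

/-- Operator relations at maximal Mermin violation: for three parties with
symmetric involutive observables, with operators of distinct parties commuting,
the eigenvector relations forced by maximal tripartite Mermin violation imply
that `A₀A₁`, `B₀B₁`, `C₀C₁` agree on `ψ`, anticommute on `ψ`, and have purely
imaginary expectation values in `ψ`. -/
theorem mermin_operator_relations (H : Type*) [NormedAddCommGroup H]
    [InnerProductSpace ℂ H]
    (A₀ A₁ B₀ B₁ C₀ C₁ : H →ₗ[ℂ] H)
    (hsymm : ∀ T ∈ [A₀, A₁, B₀, B₁, C₀, C₁], ∀ v w : H, ⟪T v, w⟫ = ⟪v, T w⟫)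
    (hinv : ∀ T ∈ [A₀, A₁, B₀, B₁, C₀, C₁], T ∘ₗ T = LinearMap.id)
    (hAB : ∀ S ∈ [A₀, A₁], ∀ T ∈ [B₀, B₁], S ∘ₗ T = T ∘ₗ S)
    (hAC : ∀ S ∈ [A₀, A₁], ∀ T ∈ [C₀, C₁], S ∘ₗ T = T ∘ₗ S)
    (hBC : ∀ S ∈ [B₀, B₁], ∀ T ∈ [C₀, C₁], S ∘ₗ T = T ∘ₗ S)
    (ψ : H)
    (h001 : A₀ (B₀ (C₁ ψ)) = ψ)
    (h010 : A₀ (B₁ (C₀ ψ)) = ψ)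
    (h100 : A₁ (B₀ (C₀ ψ)) = ψ)
    (h111 : A₁ (B₁ (C₁ ψ)) = -ψ) :
    (A₀ (A₁ ψ) = B₀ (B₁ ψ) ∧ B₀ (B₁ ψ) = C₀ (C₁ ψ)) ∧
    (A₁ (A₀ ψ) = -A₀ (A₁ ψ) ∧ B₁ (B₀ ψ) = -B₀ (B₁ ψ) ∧ C₁ (C₀ ψ) = -C₀ (C₁ ψ)) ∧
    ((⟪ψ, A₀ (A₁ ψ)⟫).re = 0 ∧ (⟪ψ, B₀ (B₁ ψ)⟫).re = 0 ∧ (⟪ψ, C₀ (C₁ ψ)⟫).re = 0) := by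
  simp only [List.mem_cons, List.not_mem_nil, or_false, forall_eq_or_imp, forall_eq]
    at hsymm hinv hAB hAC hBC
  simp only [LinearMap.ext_iff, LinearMap.comp_apply, LinearMap.id_apply] at hinv hAB hAC hBC
  obtain ⟨sA₀, sA₁, sB₀, sB₁, sC₀, sC₁⟩ := hsymm
  obtain ⟨iA₀, iA₁, iB₀, iB₁, iC₀, iC₁⟩ := hinv
  obtain ⟨⟨ab00, ab01⟩, ab10, ab11⟩ := hAB
  obtain ⟨⟨ac00, ac01⟩, ac10, ac11⟩ := hAC
  obtain ⟨⟨bc00, bc01⟩, bc10, bc11⟩ := hBC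
  have a1 : A₀ ψ = B₀ (C₁ ψ) := by
    have := congrArg A₀ h001
    rw [iA₀] at this
    exact this.symm
  have a2 : A₀ ψ = B₁ (C₀ ψ) := by
    have := congrArg A₀ h010
    rw [iA₀] at this
    exact this.symm
  have a3 : A₁ ψ = B₀ (C₀ ψ) := by
    have := congrArg A₁ h100
    rw [iA₁] at this
    exact this.symm
  have a4 : A₁ ψ = -B₁ (C₁ ψ) := by
    have := congrArg A₁ h111
    rw [iA₁, map_neg] at this
    rw [this, neg_neg]
  have e1 : A₀ (A₁ ψ) = C₀ (C₁ ψ) := by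
    rw [a3, ab00, ac00, a1, ← bc00, iB₀]
  have e2 : A₀ (A₁ ψ) = B₀ (B₁ ψ) := by
    rw [a3, ab00, ac00, a2, ← bc10, iC₀]
  have e3 : A₀ (A₁ ψ) = -B₁ (B₀ ψ) := by
    rw [a4, map_neg, ab01, ac01, a1, ← bc01, iC₁]
  have e4 : A₀ (A₁ ψ) = -C₁ (C₀ ψ) := by
    rw [a4, map_neg, ab01, ac01, a2, ← bc11, iB₁]
  have e5 : A₁ (A₀ ψ) = C₁ (C₀ ψ) := by
    rw [a1, ab10, ac11, a3, ← bc01, iB₀]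
  have e6 : A₁ (A₀ ψ) = -A₀ (A₁ ψ) := by rw [e5, e4, neg_neg]
  have r : (⟪ψ, A₀ (A₁ ψ)⟫).re = 0 := by
    have h1 : ⟪ψ, A₀ (A₁ ψ)⟫ = -⟪A₀ (A₁ ψ), ψ⟫ := by
      rw [← sA₀, ← sA₁, e6, inner_neg_left]
    have h2 := congrArg Complex.re h1
    have h3 : (⟪A₀ (A₁ ψ), ψ⟫).re = (⟪ψ, A₀ (A₁ ψ)⟫).re :=
      inner_re_symm (𝕜 := ℂ) _ _
    rw [Complex.neg_re, h3] at h2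
    linarith
  refine ⟨⟨e2, e2.symm.trans e1⟩, ⟨e6, ?_, ?_⟩, r, e2 ▸ r, e1 ▸ r⟩
  · rw [← e2, e3, neg_neg]
  · rw [← e1, e4, neg_neg]
end

section
/- Let t : ℝ and α : ℝ with α > 0. Define u = (1, 1, 1, −1) and r = (−t, t, t, t) as vectors in Fin 4 → ℝ, and let E : Matrix (Fin 4) (Fin 4) ℝ be given by E i j = u i * u j − (r i * r j) / α. If E is positive semidefinite (Matrix.PosSemidef E), then t = 0. -/
/-- The Schur-complement step of the paper's Lemma 2: subtracting from the
rank-one matrix built on `u = (1,1,1,-1)` the rescaled rank-one matrix built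
from `r = t•(-1,1,1,1)` yields a positive semidefinite matrix only if `t = 0`. -/
theorem schur_step_forces_zero (t α : ℝ) (hα : 0 < α)
    (hpsd : (Matrix.of fun i j : Fin 4 =>
        (![1, 1, 1, -1] : Fin 4 → ℝ) i * (![1, 1, 1, -1] : Fin 4 → ℝ) j -
          (![-t, t, t, t] : Fin 4 → ℝ) i * (![-t, t, t, t] : Fin 4 → ℝ) j / α).PosSemidef) :
    t = 0 := by
  have h := hpsd.dotProduct_mulVec_nonneg ![1, -1, 0, 0]
  simp [Matrix.mulVec, dotProduct, Fin.sum_univ_four] at h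
  have h2 : 0 ≤ -(4 * (t * t / α)) := by
    ring_nf at h ⊢
    linarith
  have h3 : t * t / α = 0 :=
    le_antisymm (by linarith) (div_nonneg (mul_self_nonneg t) hα.le)
  have h4 : t * t = 0 := by
    rcases div_eq_zero_iff.mp h3 with h | h
    · exact h
    · exact absurd h hα.ne'
  exact mul_self_eq_zero.mp h4
end

section
/- (Lemma 2 / Theorem 2, matrix form: uniqueness of the Q^{1+ABC} moment matrix at maximal Mermin violation.) For every v = (α₀, α₁, β₀, β₁, γ₀, γ₁) ∈ ℝ⁶, the 15×15 real symmetric matrix Γ(v) defined in the context is positive semidefinite (Matrix.PosSemidef) if and only if α₀ = α₁ = β₀ = β₁ = γ₀ = γ₁ = 0. (The matrix Γ(0) is the matrix Γ_M of the paper, and it is positive semidefinite.) -/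
/-- The general form, established in the paper's Lemma 1, of a `Q^{1+ABC}`
moment matrix compatible with the maximal violation `4` of the tripartite
Mermin inequality, parametrized by the single-body expectation values
`v = (⟨A₀⟩, ⟨A₁⟩, ⟨B₀⟩, ⟨B₁⟩, ⟨C₀⟩, ⟨C₁⟩)`.  The operator basis indexing rows
and columns is `(𝟙, A₀, A₁, B₀, B₁, C₀, C₁, A₀B₁C₁, A₁B₀C₁, A₁B₁C₀, A₀B₀C₀,
A₁B₀C₀, A₀B₁C₀, A₀B₀C₁, A₁B₁C₁)`. -/
def merminMoment (v : Fin 6 → ℝ) : Matrix (Fin 15) (Fin 15) ℝ :=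
  Matrix.of
    ![![1, v 0, v 1, v 2, v 3, v 4, v 5, 0, 0, 0, 0, 1, 1, 1, -1],
      ![v 0, 1, 0, v 5, v 4, v 3, v 2, -v 1, v 1, v 1, v 1, v 0, v 0, v 0, -v 0],
      ![v 1, 0, 1, v 4, -v 5, v 2, -v 3, -v 0, v 0, v 0, v 0, v 1, v 1, v 1, -v 1],
      ![v 2, v 5, v 4, 1, 0, v 1, v 0, v 3, -v 3, v 3, v 3, v 2, v 2, v 2, -v 2],
      ![v 3, v 4, -v 5, 0, 1, v 0, -v 1, v 2, -v 2, v 2, v 2, v 3, v 3, v 3, -v 3],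
      ![v 4, v 3, v 2, v 1, v 0, 1, 0, v 5, v 5, -v 5, v 5, v 4, v 4, v 4, -v 4],
      ![v 5, v 2, -v 3, v 0, -v 1, 0, 1, v 4, v 4, -v 4, v 4, v 5, v 5, v 5, -v 5],
      ![0, -v 1, -v 0, v 3, v 2, v 5, v 4, 1, 1, 1, -1, 0, 0, 0, 0],
      ![0, v 1, v 0, -v 3, -v 2, v 5, v 4, 1, 1, 1, -1, 0, 0, 0, 0],
      ![0, v 1, v 0, v 3, v 2, -v 5, -v 4, 1, 1, 1, -1, 0, 0, 0, 0],
      ![0, v 1, v 0, v 3, v 2, v 5, v 4, -1, -1, -1, 1, 0, 0, 0, 0],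
      ![1, v 0, v 1, v 2, v 3, v 4, v 5, 0, 0, 0, 0, 1, 1, 1, -1],
      ![1, v 0, v 1, v 2, v 3, v 4, v 5, 0, 0, 0, 0, 1, 1, 1, -1],
      ![1, v 0, v 1, v 2, v 3, v 4, v 5, 0, 0, 0, 0, 1, 1, 1, -1],
      ![-1, -v 0, -v 1, -v 2, -v 3, -v 4, -v 5, 0, 0, 0, 0, -1, -1, -1, 1]]

/-- If `x = e_j - e_k` is isotropic for a positive semidefinite `M`, then `M x = 0`
at every index where the diagonal entry is `1`. -/
lemma posSemidef_col_eq {n : ℕ} {M : Matrix (Fin n) (Fin n) ℝ} (h : M.PosSemidef)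
    (i j k : Fin n) (hi : M i i = 1) (hjk : M j j - M j k - M k j + M k k = 0) :
    M i j = M i k := by
  have hs : ∀ a b, M a b = M b a := fun a b => by
    simpa using h.isHermitian.apply b a
  have hq := h.dotProduct_mulVec_nonneg
    (Pi.single j 1 - Pi.single k 1 - (M i j - M i k) • Pi.single i 1)
  simp only [star_trivial, Matrix.mulVec_sub, Matrix.mulVec_smul, sub_dotProduct,
    dotProduct_sub, smul_dotProduct, dotProduct_smul, Matrix.mulVec_single_one,
    single_one_dotProduct, Matrix.col_apply, smul_eq_mul] at hq
  rw [hi, hs j i, hs k i] at hq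
  have : (M i j - M i k) ^ 2 ≤ 0 := by nlinarith
  have := pow_eq_zero_iff (two_ne_zero) |>.1 (le_antisymm this (sq_nonneg _))
  linarith

/-- The matrix at zero is positive semidefinite. -/
lemma merminMoment_zero_posSemidef : (merminMoment 0).PosSemidef := by
  refine Matrix.PosSemidef.of_dotProduct_mulVec_nonneg ?_ ?_
  · ext i j
    fin_cases i <;> fin_cases j <;> simp [merminMoment]
  · intro x
    have : dotProduct (star x) ((merminMoment 0).mulVec x) =
        (x 0 + x 11 + x 12 + x 13 - x 14) ^ 2 + (x 7 + x 8 + x 9 - x 10) ^ 2 +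
        x 1 ^ 2 + x 2 ^ 2 + x 3 ^ 2 + x 4 ^ 2 + x 5 ^ 2 + x 6 ^ 2 := by
      simp [merminMoment, dotProduct, Matrix.mulVec, Fin.sum_univ_succ]
      ring
    rw [this]
    positivity

/-- Lemma 2 / Theorem 2 of the paper in matrix form: the moment matrix
compatible with maximal tripartite Mermin violation is positive semidefinite if
and only if all single-body expectation values vanish. -/
theorem merminMoment_posSemidef_iff (v : Fin 6 → ℝ) :
    (merminMoment v).PosSemidef ↔ (∀ i, v i = 0) := by
  constructor
  · intro h
    have key := fun i k hi hk => posSemidef_col_eq h i 7 k hi hk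
    have h1 := key 1 8 (by simp [merminMoment]) (by simp [merminMoment])
    have h2 := key 2 8 (by simp [merminMoment]) (by simp [merminMoment])
    have h3 := key 3 8 (by simp [merminMoment]) (by simp [merminMoment])
    have h4 := key 4 8 (by simp [merminMoment]) (by simp [merminMoment])
    have h5 := key 5 9 (by simp [merminMoment]) (by simp [merminMoment])
    have h6 := key 6 9 (by simp [merminMoment]) (by simp [merminMoment])
    simp [merminMoment] at h1 h2 h3 h4 h5 h6
    intro i
    fin_cases i <;> simp <;> linarith
  · intro h
    have hv : v = 0 := funext h
    rw [hv]
    exact merminMoment_zero_posSemidef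
end

section
/- (Corollary: maximal randomness in Q^{1+ABC} at maximal Mermin violation.) Let v = (α₀, α₁, β₀, β₁, γ₀, γ₁) ∈ ℝ⁶ and suppose the 15×15 matrix Γ(v) defined in the context is positive semidefinite. Define the tripartite output distribution for the input (0,0,0) by p_v(a) = (1/8) * (1 + (−1)^{a₀} α₀ + (−1)^{a₁} β₀ + (−1)^{a₂} γ₀ + (−1)^{a₀+a₁} γ₁ + (−1)^{a₀+a₂} β₁ + (−1)^{a₁+a₂} α₁) for a = (a₀,a₁,a₂) : Fin 3 → Fin 2 (with the a_i cast to ℕ in the exponents). Then p_v(a) = 1/8 for every a. -/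
/-- Corollary: maximal randomness in `Q^{1+ABC}` at maximal Mermin violation.
The Walsh expansion of the outcome probability for settings `(0,0,0)` read off
from a positive semidefinite moment matrix equals `1/8` for every outcome. -/
theorem merminMoment_maximal_randomness (v : Fin 6 → ℝ)
    (hpsd : (merminMoment v).PosSemidef) (a : Fin 3 → Fin 2) :
    (1 / 8 : ℝ) *
        (1 + (-1 : ℝ) ^ ((a 0 : ℕ)) * v 0 + (-1 : ℝ) ^ ((a 1 : ℕ)) * v 2 +
          (-1 : ℝ) ^ ((a 2 : ℕ)) * v 4 + (-1 : ℝ) ^ ((a 0 : ℕ) + (a 1 : ℕ)) * v 5 +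
          (-1 : ℝ) ^ ((a 0 : ℕ) + (a 2 : ℕ)) * v 3 +
          (-1 : ℝ) ^ ((a 1 : ℕ) + (a 2 : ℕ)) * v 1) = 1 / 8 := by
  have key : ∀ x : Fin 15 → ℝ, star x ⬝ᵥ (merminMoment v).mulVec x = 0 →
      (merminMoment v).mulVec x = 0 := fun x hx => (hpsd.dotProduct_mulVec_zero_iff x).1 hx
  have h1 := key ![0,0,0,0,0,0,0,1,-1,0,0,0,0,0,0] (by
    simp [merminMoment, Matrix.mulVec, dotProduct, Fin.sum_univ_succ])
  have h2 := key ![0,0,0,0,0,0,0,1,0,-1,0,0,0,0,0] (by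
    simp [merminMoment, Matrix.mulVec, dotProduct, Fin.sum_univ_succ])
  have e0 : v 0 = 0 := by
    have := congrFun h1 2
    simp [merminMoment, Matrix.mulVec, dotProduct, Fin.sum_univ_succ] at this
    linarith
  have e1 : v 1 = 0 := by
    have := congrFun h1 1
    simp [merminMoment, Matrix.mulVec, dotProduct, Fin.sum_univ_succ] at this
    linarith
  have e2 : v 2 = 0 := by
    have := congrFun h1 4
    simp [merminMoment, Matrix.mulVec, dotProduct, Fin.sum_univ_succ] at this
    linarith
  have e3 : v 3 = 0 := by
    have := congrFun h1 3
    simp [merminMoment, Matrix.mulVec, dotProduct, Fin.sum_univ_succ] at this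
    linarith
  have e4 : v 4 = 0 := by
    have := congrFun h2 6
    simp [merminMoment, Matrix.mulVec, dotProduct, Fin.sum_univ_succ] at this
    linarith
  have e5 : v 5 = 0 := by
    have := congrFun h2 5
    simp [merminMoment, Matrix.mulVec, dotProduct, Fin.sum_univ_succ] at this
    linarith
  simp [e0, e1, e2, e3, e4, e5]
end
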